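/- Let (𝒫,𝒬,σ), (𝒫̃,𝒬̃,σ̃), (𝒫̂,𝒬̂,σ̂) be elements of B_n. Suppose that d((𝒫,𝒬,σ),(𝒫̃,𝒬̃,σ̃)) < 1/4 and d((𝒫,𝒬,σ),(𝒫̂,𝒬̂,σ̂)) < 1/4, and let τ̃: 𝒫 → 𝒫̃ and τ̂: 𝒫 → 𝒫̂ be bijections realizing the minima in the definitions of these two distances, respectively. If d((𝒫̃,𝒬̃,σ̃),(𝒫̂,𝒬̂,σ̂)) < ε, then ‖τ̃(P) − τ̂(P)‖ < ε for every P ∈ 𝒫. -/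

import Mathlib

noncomputable section

abbrev Mat (n : ℕ) : Type := Matrix (Fin n) (Fin n) ℂ

/-- Operator norm on matrices induced by the Euclidean norm on `ℂⁿ`. -/
noncomputable def opNorm {n : ℕ} (A : Mat n) : ℝ :=
  ‖(Matrix.toEuclideanCLM (𝕜 := ℂ) (n := Fin n)) A‖

/-- An orthogonal decomposition of `ℂⁿ`: a set of `n` pairwise orthogonal rank-one
orthogonal projections summing to the identity. -/
structure OrthDecomp (n : ℕ) where
  carrier : Finset (Mat n)
  card_eq : carrier.card = n
  herm : ∀ P ∈ carrier, P.conjTranspose = P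
  idem : ∀ P ∈ carrier, P * P = P
  rank_one : ∀ P ∈ carrier, P.rank = 1
  orth : ∀ P ∈ carrier, ∀ Q ∈ carrier, P ≠ Q → P * Q = 0
  sum_eq : (∑ P ∈ carrier, P) = 1

/-- The space `B_n` of triples `(𝒫, 𝒬, σ)`. -/
structure Bn (n : ℕ) where
  decA : OrthDecomp n
  decB : OrthDecomp n
  bij : {M // M ∈ decA.carrier} ≃ {M // M ∈ decB.carrier}

/-- The quantity `max_{P ∈ 𝒫} max(‖P − τ(P)‖, ‖σ(P) − σ̃(τ(P))‖)` for a bijection `τ`. -/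
noncomputable def tripVal {n : ℕ} (a b : Bn n)
    (τ : {M // M ∈ a.decA.carrier} ≃ {M // M ∈ b.decA.carrier}) : ℝ :=
  ⨆ P : {M // M ∈ a.decA.carrier},
    max (opNorm ((P : Mat n) - (τ P : Mat n)))
        (opNorm ((a.bij P : Mat n) - (b.bij (τ P) : Mat n)))

/-- The distance function `d` on `B_n`. -/
noncomputable def Bdist {n : ℕ} (a b : Bn n) : ℝ :=
  ⨅ τ : {M // M ∈ a.decA.carrier} ≃ {M // M ∈ b.decA.carrier}, tripVal a b τ

theorem opNorm_mul_le {n : ℕ} (A B : Mat n) : opNorm (A * B) ≤ opNorm A * opNorm B := by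
  simpa [opNorm] using norm_mul_le (Matrix.toEuclideanCLM (𝕜 := ℂ) (n := Fin n) A)
    (Matrix.toEuclideanCLM (𝕜 := ℂ) (n := Fin n) B)

theorem opNorm_pos {n : ℕ} {A : Mat n} (hA : A ≠ 0) : 0 < opNorm A := by
  simpa [opNorm] using hA

theorem opNorm_sub_comm {n : ℕ} (A B : Mat n) : opNorm (A - B) = opNorm (B - A) := by
  simpa [opNorm] using norm_sub_rev (Matrix.toEuclideanCLM (𝕜 := ℂ) (n := Fin n) A)
    (Matrix.toEuclideanCLM (𝕜 := ℂ) (n := Fin n) B)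

theorem opNorm_sub_le_add {n : ℕ} (A B C : Mat n) :
    opNorm (A - C) ≤ opNorm (A - B) + opNorm (B - C) := by
  simpa [opNorm] using norm_sub_le_norm_sub_add_norm_sub
    (Matrix.toEuclideanCLM (𝕜 := ℂ) (n := Fin n) A)
    (Matrix.toEuclideanCLM (𝕜 := ℂ) (n := Fin n) B)
    (Matrix.toEuclideanCLM (𝕜 := ℂ) (n := Fin n) C)

/-- Distinct members of an orthogonal decomposition are at distance at least one. -/
theorem OrthDecomp.one_le_opNorm_sub {n : ℕ} (D : OrthDecomp n) {P Q : Mat n}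
    (hP : P ∈ D.carrier) (hQ : Q ∈ D.carrier) (hPQ : P ≠ Q) : 1 ≤ opNorm (P - Q) := by
  have hP0 : P ≠ 0 := by
    rintro rfl
    simpa using D.rank_one 0 hP
  have hmul : (P - Q) * P = P := by
    rw [sub_mul, D.idem P hP, D.orth Q hQ P hP hPQ.symm, sub_zero]
  have h := opNorm_mul_le (P - Q) P
  rw [hmul] at h
  exact (le_mul_iff_one_le_left (opNorm_pos hP0)).mp h

theorem opNorm_sub_le_tripVal {n : ℕ} (a b : Bn n)
    (τ : {M // M ∈ a.decA.carrier} ≃ {M // M ∈ b.decA.carrier})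
    (P : {M // M ∈ a.decA.carrier}) : opNorm ((P : Mat n) - (τ P : Mat n)) ≤ tripVal a b τ :=
  (le_max_left _ _).trans <| le_ciSup (f := fun P : {M // M ∈ a.decA.carrier} ↦
    max (opNorm ((P : Mat n) - (τ P : Mat n)))
      (opNorm ((a.bij P : Mat n) - (b.bij (τ P) : Mat n)))) (Set.finite_range _).bddAbove P

/-- if `d(a,b) < 1/4` and `d(a,c) < 1/4` are realized by bijections
`τb`, `τc`, and `d(b,c) < ε`, then `‖τb(P) − τc(P)‖ < ε` for every `P ∈ 𝒫`. -/
theorem realizing_bijections_close {n : ℕ} (hn : 1 ≤ n) (a b c : Bn n)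
    (hab : Bdist a b < 1 / 4) (hac : Bdist a c < 1 / 4)
    (τb : {M // M ∈ a.decA.carrier} ≃ {M // M ∈ b.decA.carrier})
    (τc : {M // M ∈ a.decA.carrier} ≃ {M // M ∈ c.decA.carrier})
    (hτb : tripVal a b τb = Bdist a b) (hτc : tripVal a c τc = Bdist a c)
    (ε : ℝ) (hbc : Bdist b c < ε) :
    ∀ P : {M // M ∈ a.decA.carrier}, opNorm ((τb P : Mat n) - (τc P : Mat n)) < ε := by
  intro P
  have : Nonempty ({M // M ∈ b.decA.carrier} ≃ {M // M ∈ c.decA.carrier}) :=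
    ⟨τb.symm.trans τc⟩
  obtain ⟨τ, hτ⟩ := exists_eq_ciInf_of_finite (f := tripVal b c)
  change tripVal b c τ = Bdist b c at hτ
  have hbP := opNorm_sub_le_tripVal a b τb P
  have hcP := opNorm_sub_le_tripVal a c τc P
  have hτP := opNorm_sub_le_tripVal b c τ (τb P)
  have hhalf := opNorm_sub_le_add (τb P : Mat n) P (τc P)
  rw [opNorm_sub_comm (τb P : Mat n) P] at hhalf
  by_cases hP : τ (τb P) = τc P
  · rw [hP] at hτP
    linarith
  · have hone := c.decA.one_le_opNorm_sub (τ (τb P)).2 (τc P).2 (Subtype.coe_injective.ne hP)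
    have htri := opNorm_sub_le_add (τ (τb P) : Mat n) (τb P) (τc P)
    rw [opNorm_sub_comm (τ (τb P) : Mat n) (τb P)] at htri
    linarith
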